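/- arXiv:2004.07221 — 2 statements merged into one kernel-verified Lean document; each statement's English description precedes it below -/
import Mathlib

section
/- Every ontology-mediated query q = (O, ψ(t⃗)), where O is an LTL_bool^□○ ontology and ψ(t⃗) an MFO(<)-formula with free (answer) variables t⃗ = (t₁,…,t_m), is FO(RPR)-rewritable: there is an FO(RPR)-formula q(t⃗) such that, for every data instance A and every tuple ℓ⃗ in tem(A), ℓ⃗ is a certain answer to q over A iff S_A ⊨ q(ℓ⃗). -/
namespace LTLOMQ

/-! ## Temporal concepts (LTL formulas) and their semantics over (ℤ,<) -/

/-- Temporal concepts: arbitrary LTL formulas over atomic concepts indexed by `ℕ`. -/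
inductive TC : Type where
  | top : TC
  | atom : ℕ → TC
  | neg : TC → TC
  | and : TC → TC → TC
  | or : TC → TC → TC
  | nextF : TC → TC
  | diamF : TC → TC
  | boxF : TC → TC
  | untl : TC → TC → TC
  | nextP : TC → TC
  | diamP : TC → TC
  | boxP : TC → TC
  | since : TC → TC → TC

/-- A temporal interpretation assigns to each atomic concept a subset of ℤ. -/
abbrev Itp : Type := ℕ → Set ℤ

/-- The extension of a temporal concept in an interpretation
(strict semantics over `(ℤ,<)`). -/
def TC.sem (M : Itp) : TC → Set ℤ
  | .top => Set.univ
  | .atom a => M a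
  | .neg C => (TC.sem M C)ᶜ
  | .and C D => TC.sem M C ∩ TC.sem M D
  | .or C D => TC.sem M C ∪ TC.sem M D
  | .nextF C => {n | n + 1 ∈ TC.sem M C}
  | .diamF C => {n | ∃ k, n < k ∧ k ∈ TC.sem M C}
  | .boxF C => {n | ∀ k, n < k → k ∈ TC.sem M C}
  | .untl C D => {n | ∃ k, n < k ∧ k ∈ TC.sem M D ∧ ∀ m, n < m → m < k → m ∈ TC.sem M C}
  | .nextP C => {n | n - 1 ∈ TC.sem M C}
  | .diamP C => {n | ∃ k, k < n ∧ k ∈ TC.sem M C}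
  | .boxP C => {n | ∀ k, k < n → k ∈ TC.sem M C}
  | .since C D => {n | ∃ k, k < n ∧ k ∈ TC.sem M D ∧ ∀ m, k < m → m < n → m ∈ TC.sem M C}

/-- Basic temporal concepts: built from atomic concepts using ○F, ○P, □F, □P. -/
inductive TC.IsBasic : TC → Prop
  | atom (a : ℕ) : TC.IsBasic (.atom a)
  | nextF {C : TC} : TC.IsBasic C → TC.IsBasic (.nextF C)
  | nextP {C : TC} : TC.IsBasic C → TC.IsBasic (.nextP C)
  | boxF {C : TC} : TC.IsBasic C → TC.IsBasic (.boxF C)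
  | boxP {C : TC} : TC.IsBasic C → TC.IsBasic (.boxP C)

/-- Basic temporal concepts using □F and □P only. -/
inductive TC.IsBasicBox : TC → Prop
  | atom (a : ℕ) : TC.IsBasicBox (.atom a)
  | boxF {C : TC} : TC.IsBasicBox C → TC.IsBasicBox (.boxF C)
  | boxP {C : TC} : TC.IsBasicBox C → TC.IsBasicBox (.boxP C)

/-- Basic temporal concepts using ○F and ○P only. -/
inductive TC.IsBasicNext : TC → Prop
  | atom (a : ℕ) : TC.IsBasicNext (.atom a)
  | nextF {C : TC} : TC.IsBasicNext C → TC.IsBasicNext (.nextF C)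
  | nextP {C : TC} : TC.IsBasicNext C → TC.IsBasicNext (.nextP C)

/-- Positive temporal concepts: no occurrences of ¬. -/
inductive TC.IsPositive : TC → Prop
  | top : TC.IsPositive .top
  | atom (a : ℕ) : TC.IsPositive (.atom a)
  | and {C D : TC} : TC.IsPositive C → TC.IsPositive D → TC.IsPositive (.and C D)
  | or {C D : TC} : TC.IsPositive C → TC.IsPositive D → TC.IsPositive (.or C D)
  | nextF {C : TC} : TC.IsPositive C → TC.IsPositive (.nextF C)
  | diamF {C : TC} : TC.IsPositive C → TC.IsPositive (.diamF C)
  | boxF {C : TC} : TC.IsPositive C → TC.IsPositive (.boxF C)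
  | untl {C D : TC} : TC.IsPositive C → TC.IsPositive D → TC.IsPositive (.untl C D)
  | nextP {C : TC} : TC.IsPositive C → TC.IsPositive (.nextP C)
  | diamP {C : TC} : TC.IsPositive C → TC.IsPositive (.diamP C)
  | boxP {C : TC} : TC.IsPositive C → TC.IsPositive (.boxP C)
  | since {C D : TC} : TC.IsPositive C → TC.IsPositive D → TC.IsPositive (.since C D)

/-- Prior-LTL formulas: Boolean connectives and □P, ◇P, □F, ◇F only. -/
inductive TC.IsPrior : TC → Prop
  | atom (a : ℕ) : TC.IsPrior (.atom a)
  | neg {C : TC} : TC.IsPrior C → TC.IsPrior (.neg C)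
  | and {C D : TC} : TC.IsPrior C → TC.IsPrior D → TC.IsPrior (.and C D)
  | or {C D : TC} : TC.IsPrior C → TC.IsPrior D → TC.IsPrior (.or C D)
  | boxF {C : TC} : TC.IsPrior C → TC.IsPrior (.boxF C)
  | boxP {C : TC} : TC.IsPrior C → TC.IsPrior (.boxP C)
  | diamF {C : TC} : TC.IsPrior C → TC.IsPrior (.diamF C)
  | diamP {C : TC} : TC.IsPrior C → TC.IsPrior (.diamP C)

/-- Number of occurrences of temporal operators in a temporal concept. -/
def TC.tempOps : TC → ℕ
  | .top => 0
  | .atom _ => 0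
  | .neg C => TC.tempOps C
  | .and C D => TC.tempOps C + TC.tempOps D
  | .or C D => TC.tempOps C + TC.tempOps D
  | .nextF C => TC.tempOps C + 1
  | .diamF C => TC.tempOps C + 1
  | .boxF C => TC.tempOps C + 1
  | .untl C D => TC.tempOps C + TC.tempOps D + 1
  | .nextP C => TC.tempOps C + 1
  | .diamP C => TC.tempOps C + 1
  | .boxP C => TC.tempOps C + 1
  | .since C D => TC.tempOps C + TC.tempOps D + 1

/-- Number of occurrences of symbols in a temporal concept. -/
def TC.size : TC → ℕ
  | .top => 1
  | .atom _ => 1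
  | .neg C => TC.size C + 1
  | .and C D => TC.size C + TC.size D + 1
  | .or C D => TC.size C + TC.size D + 1
  | .nextF C => TC.size C + 1
  | .diamF C => TC.size C + 1
  | .boxF C => TC.size C + 1
  | .untl C D => TC.size C + TC.size D + 1
  | .nextP C => TC.size C + 1
  | .diamP C => TC.size C + 1
  | .boxP C => TC.size C + 1
  | .since C D => TC.size C + TC.size D + 1

/-- The set of subconcepts of a temporal concept. -/
def TC.subs : TC → Set TC
  | .top => {.top}
  | .atom a => {.atom a}
  | .neg C => insert (.neg C) (TC.subs C)
  | .and C D => insert (.and C D) (TC.subs C ∪ TC.subs D)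
  | .or C D => insert (.or C D) (TC.subs C ∪ TC.subs D)
  | .nextF C => insert (.nextF C) (TC.subs C)
  | .diamF C => insert (.diamF C) (TC.subs C)
  | .boxF C => insert (.boxF C) (TC.subs C)
  | .untl C D => insert (.untl C D) (TC.subs C ∪ TC.subs D)
  | .nextP C => insert (.nextP C) (TC.subs C)
  | .diamP C => insert (.diamP C) (TC.subs C)
  | .boxP C => insert (.boxP C) (TC.subs C)
  | .since C D => insert (.since C D) (TC.subs C ∪ TC.subs D)

/-- The set of atomic concepts occurring in a temporal concept. -/
def TC.atoms : TC → Set ℕ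
  | .top => ∅
  | .atom a => {a}
  | .neg C => TC.atoms C
  | .and C D => TC.atoms C ∪ TC.atoms D
  | .or C D => TC.atoms C ∪ TC.atoms D
  | .nextF C => TC.atoms C
  | .diamF C => TC.atoms C
  | .boxF C => TC.atoms C
  | .untl C D => TC.atoms C ∪ TC.atoms D
  | .nextP C => TC.atoms C
  | .diamP C => TC.atoms C
  | .boxP C => TC.atoms C
  | .since C D => TC.atoms C ∪ TC.atoms D

/-! ## Clauses, ontologies, data instances -/

/-- A clause `C₁ ∧ … ∧ C_k → C_{k+1} ∨ … ∨ C_{k+m}`. -/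
structure Clause : Type where
  prem : List TC
  concl : List TC

/-- A clause is true in `M` if the intersection of the extensions of the premises
is contained in the union of the extensions of the conclusions. -/
def Clause.holds (M : Itp) (cl : Clause) : Prop :=
  ∀ n : ℤ, (∀ C ∈ cl.prem, n ∈ TC.sem M C) → ∃ C ∈ cl.concl, n ∈ TC.sem M C

/-- An ontology is a finite set (list) of clauses. -/
abbrev Ontology : Type := List Clause

def Clause.AllBasic (cl : Clause) : Prop :=
  (∀ C ∈ cl.prem, C.IsBasic) ∧ (∀ C ∈ cl.concl, C.IsBasic)

def Clause.AllBasicBox (cl : Clause) : Prop :=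
  (∀ C ∈ cl.prem, C.IsBasicBox) ∧ (∀ C ∈ cl.concl, C.IsBasicBox)

def Clause.AllBasicNext (cl : Clause) : Prop :=
  (∀ C ∈ cl.prem, C.IsBasicNext) ∧ (∀ C ∈ cl.concl, C.IsBasicNext)

/-- Horn: at most one disjunct in the conclusion. -/
def Clause.Horn (cl : Clause) : Prop := cl.concl.length ≤ 1

/-- Krom (binary): at most two concepts altogether. -/
def Clause.Krom (cl : Clause) : Prop := cl.prem.length + cl.concl.length ≤ 2

/-- LTL_bool^□○ ontologies. -/
def Ontology.BoolBoxNext (O : Ontology) : Prop := ∀ cl ∈ O, cl.AllBasic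
/-- LTL_bool^□ ontologies. -/
def Ontology.BoolBox (O : Ontology) : Prop := ∀ cl ∈ O, cl.AllBasicBox
/-- LTL_krom^○ ontologies. -/
def Ontology.KromNext (O : Ontology) : Prop := ∀ cl ∈ O, cl.AllBasicNext ∧ cl.Krom
/-- LTL_krom^□○ ontologies. -/
def Ontology.KromBoxNext (O : Ontology) : Prop := ∀ cl ∈ O, cl.AllBasic ∧ cl.Krom
/-- LTL_horn^□○ ontologies. -/
def Ontology.HornBoxNext (O : Ontology) : Prop := ∀ cl ∈ O, cl.AllBasic ∧ cl.Horn
/-- LTL_horn^□ ontologies. -/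
def Ontology.HornBox (O : Ontology) : Prop := ∀ cl ∈ O, cl.AllBasicBox ∧ cl.Horn
/-- LTL_core^□○ ontologies. -/
def Ontology.CoreBoxNext (O : Ontology) : Prop := ∀ cl ∈ O, cl.AllBasic ∧ cl.Horn ∧ cl.Krom

/-- Number of occurrences of symbols in a clause. -/
def Clause.size (cl : Clause) : ℕ :=
  (cl.prem.map TC.size).sum + (cl.concl.map TC.size).sum + 1

/-- Number of occurrences of symbols in an ontology. -/
def Ontology.size (O : Ontology) : ℕ := (O.map Clause.size).sum

/-- The atomic concept `a` occurs in the ontology `O`. -/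
def Ontology.occurs (O : Ontology) (a : ℕ) : Prop :=
  ∃ cl ∈ O, (∃ C ∈ cl.prem, a ∈ C.atoms) ∨ (∃ C ∈ cl.concl, a ∈ C.atoms)

/-- The set of subconcepts of (concepts occurring in) an ontology. -/
def Ontology.subs (O : Ontology) : Set TC :=
  {C | ∃ cl ∈ O, ∃ D : TC, (D ∈ cl.prem ∨ D ∈ cl.concl) ∧ C ∈ D.subs}

/-- A flat concept: an atomic concept, or a single ○F or ○P applied to an atomic concept. -/
def TC.IsFlat : TC → Prop
  | .atom _ => True
  | .nextF (.atom _) => True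
  | .nextP (.atom _) => True
  | _ => False

/-- An ontology without nested temporal operators. -/
def Ontology.Flat (O : Ontology) : Prop :=
  ∀ cl ∈ O, (∀ C ∈ cl.prem, C.IsFlat) ∧ (∀ C ∈ cl.concl, C.IsFlat)

/-- A data instance: a finite nonempty set of timestamped atoms, normalized so that
the minimal timestamp is 0 and the maximal one is ≥ 1. -/
structure DataInstance : Type where
  atoms : Finset (ℕ × ℤ)
  nonneg : ∀ p ∈ atoms, 0 ≤ p.2
  has_zero : ∃ p ∈ atoms, p.2 = 0
  has_one : ∃ p ∈ atoms, 1 ≤ p.2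

theorem DataInstance.ts_nonempty (A : DataInstance) :
    (A.atoms.image Prod.snd).Nonempty := by
  obtain ⟨p, hp, -⟩ := A.has_zero
  exact ⟨p.2, Finset.mem_image_of_mem _ hp⟩

/-- min A: the minimal timestamp occurring in the data instance (equal to 0). -/
def DataInstance.minT (A : DataInstance) : ℤ :=
  (A.atoms.image Prod.snd).min' A.ts_nonempty

/-- max A: the maximal timestamp occurring in the data instance. -/
def DataInstance.maxT (A : DataInstance) : ℤ :=
  (A.atoms.image Prod.snd).max' A.ts_nonempty

/-- The active temporal domain tem(A). -/
def DataInstance.tem (A : DataInstance) : Set ℤ := Set.Icc A.minT A.maxT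

/-- The interpretation of atomic concepts in the first-order structure S_A. -/
def DataInstance.itp (A : DataInstance) : Itp := fun a => {n | (a, n) ∈ A.atoms}

/-- `M` is a model of the knowledge base `(O, A)`. -/
def IsModel (M : Itp) (O : Ontology) (A : DataInstance) : Prop :=
  (∀ cl ∈ O, cl.holds M) ∧ ∀ p ∈ A.atoms, p.2 ∈ M p.1

/-- The ontology `O` is consistent. -/
def Ontology.Consistent (O : Ontology) : Prop := ∃ M : Itp, ∀ cl ∈ O, cl.holds M

/-- The data instance `A` is consistent with `O`. -/
def ConsistentWith (O : Ontology) (A : DataInstance) : Prop := ∃ M : Itp, IsModel M O A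

/-- Certain answers to the OMIQ `(O, κ)` over `A` (within the active domain). -/
def certAns (O : Ontology) (κ : TC) (A : DataInstance) : Set ℤ :=
  {ℓ | ℓ ∈ A.tem ∧ ∀ M : Itp, IsModel M O A → ℓ ∈ TC.sem M κ}

/-- Certain answers to the OMIQ `(O, κ)` over `A` and ℤ. -/
def certAnsZ (O : Ontology) (κ : TC) (A : DataInstance) : Set ℤ :=
  {ℓ | ∀ M : Itp, IsModel M O A → ℓ ∈ TC.sem M κ}

/-! ## First-order, MSO and FO(RPR) formulas over the temporal structures -/

/-- Formulas of the target languages: first-order variables are indexed by `ℕ`,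
as are second-order (set) variables and the recursively defined relation variables
of FO(RPR).  The constructors `qprev j` and `qapp j x` stand for `Q_j(t-1)` (inside
a recursive definition block) and `Q_j(x)`, respectively; `rpr n Θ tv ψ` is the
relational-primitive-recursion construct `[Q₁(t) ≡ Θ₁; …; Q_n(t) ≡ Θ_n] ψ`
with recursion variable `tv`. -/
inductive Fml : Type where
  | falsum : Fml
  | atom : ℕ → ℕ → Fml        -- A(x)
  | lt : ℕ → ℕ → Fml          -- x < y
  | eq : ℕ → ℕ → Fml          -- x = y
  | succ : ℕ → ℕ → Fml        -- x = y + 1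
  | mod : ℕ → ℕ → Fml         -- x ≡ 0 (mod n)
  | svar : ℕ → ℕ → Fml        -- X(x), X a set variable
  | qprev : ℕ → Fml           -- Q_j(t−1)
  | qapp : ℕ → ℕ → Fml        -- Q_j(x)
  | neg : Fml → Fml
  | and : Fml → Fml → Fml
  | or : Fml → Fml → Fml
  | ex : ℕ → Fml → Fml
  | all : ℕ → Fml → Fml
  | exS : ℕ → Fml → Fml       -- second-order ∃
  | allS : ℕ → Fml → Fml      -- second-order ∀
  | rpr : (n : ℕ) → (Fin n → Fml) → ℕ → Fml → Fml

/-- Evaluation of a formula over the structure with (active) domain `D ⊆ ℤ`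
and interpretation `I` of the unary predicates; `env` assigns first-order
variables, `senv` set variables, `prev` the placeholders `Q_j(t-1)` and
`Q` the defined relation variables. First-order quantifiers range over `D`,
second-order quantifiers over subsets of `D`. -/
def Fml.eval (D : Set ℤ) (I : ℕ → Set ℤ) :
    Fml → (ℕ → ℤ) → (ℕ → Set ℤ) → (ℕ → Prop) → (ℕ → ℤ → Prop) → Prop
  | .falsum, _, _, _, _ => False
  | .atom a x, env, _, _, _ => env x ∈ I a
  | .lt x y, env, _, _, _ => env x < env y
  | .eq x y, env, _, _, _ => env x = env y
  | .succ x y, env, _, _, _ => env x = env y + 1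
  | .mod n x, env, _, _, _ => (n : ℤ) ∣ env x
  | .svar X x, env, senv, _, _ => env x ∈ senv X
  | .qprev j, _, _, prev, _ => prev j
  | .qapp j x, env, _, _, Q => Q j (env x)
  | .neg φ, env, senv, prev, Q => ¬ Fml.eval D I φ env senv prev Q
  | .and φ ψ, env, senv, prev, Q =>
      Fml.eval D I φ env senv prev Q ∧ Fml.eval D I ψ env senv prev Q
  | .or φ ψ, env, senv, prev, Q =>
      Fml.eval D I φ env senv prev Q ∨ Fml.eval D I ψ env senv prev Q
  | .ex x φ, env, senv, prev, Q =>
      ∃ d ∈ D, Fml.eval D I φ (Function.update env x d) senv prev Q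
  | .all x φ, env, senv, prev, Q =>
      ∀ d ∈ D, Fml.eval D I φ (Function.update env x d) senv prev Q
  | .exS X φ, env, senv, prev, Q =>
      ∃ S : Set ℤ, S ⊆ D ∧ Fml.eval D I φ env (Function.update senv X S) prev Q
  | .allS X φ, env, senv, prev, Q =>
      ∀ S : Set ℤ, S ⊆ D → Fml.eval D I φ env (Function.update senv X S) prev Q
  | .rpr n Θ tv ψ, env, senv, prev, Q =>
      -- the semantics of each Θ_j, as a function of the first-order environment
      -- and of the truth values of the `Q_j(t−1)` placeholders
      let f : Fin n → (ℕ → ℤ) → (ℕ → Prop) → Prop :=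
        fun j env' prev' => Fml.eval D I (Θ j) env' senv prev' Q
      -- the recursively computed truth values of `Q_j` at time `k` (recursion on k from 0)
      let recQ : ℕ → Fin n → Prop := fun k =>
        Nat.rec (fun j => f j (Function.update env tv 0) (fun _ => False))
          (fun m ih j => f j (Function.update env tv ((m : ℤ) + 1))
            (fun i => ∃ h : i < n, ih ⟨i, h⟩)) k
      Fml.eval D I ψ env senv prev
        (fun j z => ∃ h : j < n, 0 ≤ z ∧ recQ z.toNat ⟨j, h⟩)

/-- Free first-order variables of a formula. -/
def Fml.fvars : Fml → Set ℕ
  | .falsum => ∅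
  | .atom _ x => {x}
  | .lt x y => {x, y}
  | .eq x y => {x, y}
  | .succ x y => {x, y}
  | .mod _ x => {x}
  | .svar _ x => {x}
  | .qprev _ => ∅
  | .qapp _ x => {x}
  | .neg φ => Fml.fvars φ
  | .and φ ψ => Fml.fvars φ ∪ Fml.fvars ψ
  | .or φ ψ => Fml.fvars φ ∪ Fml.fvars ψ
  | .ex x φ => Fml.fvars φ \ {x}
  | .all x φ => Fml.fvars φ \ {x}
  | .exS _ φ => Fml.fvars φ
  | .allS _ φ => Fml.fvars φ
  | .rpr n Θ tv ψ => (⋃ j : Fin n, Fml.fvars (Θ j) \ {tv}) ∪ Fml.fvars ψ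

/-- FO(<)-formulas: first-order logic with the built-in linear order
(and the definable equality predicate); no constants, no arithmetic. -/
def Fml.IsFOlt : Fml → Prop
  | .falsum => True
  | .atom _ _ => True
  | .lt _ _ => True
  | .eq _ _ => True
  | .neg φ => Fml.IsFOlt φ
  | .and φ ψ => Fml.IsFOlt φ ∧ Fml.IsFOlt ψ
  | .or φ ψ => Fml.IsFOlt φ ∧ Fml.IsFOlt ψ
  | .ex _ φ => Fml.IsFOlt φ
  | .all _ φ => Fml.IsFOlt φ
  | _ => False

/-- FO(<,≡)-formulas: FO(<) extended with the predicates `t ≡ 0 (mod n)`, `n > 1`. -/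
def Fml.IsFOltMod : Fml → Prop
  | .falsum => True
  | .atom _ _ => True
  | .lt _ _ => True
  | .eq _ _ => True
  | .mod n _ => 2 ≤ n
  | .neg φ => Fml.IsFOltMod φ
  | .and φ ψ => Fml.IsFOltMod φ ∧ Fml.IsFOltMod ψ
  | .or φ ψ => Fml.IsFOltMod φ ∧ Fml.IsFOltMod ψ
  | .ex _ φ => Fml.IsFOltMod φ
  | .all _ φ => Fml.IsFOltMod φ
  | _ => False

/-- MSO(<)-formulas: FO(<) extended with set variables and second-order quantifiers. -/
def Fml.IsMSO : Fml → Prop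
  | .falsum => True
  | .atom _ _ => True
  | .lt _ _ => True
  | .eq _ _ => True
  | .svar _ _ => True
  | .neg φ => Fml.IsMSO φ
  | .and φ ψ => Fml.IsMSO φ ∧ Fml.IsMSO ψ
  | .or φ ψ => Fml.IsMSO φ ∧ Fml.IsMSO ψ
  | .ex _ φ => Fml.IsMSO φ
  | .all _ φ => Fml.IsMSO φ
  | .exS _ φ => Fml.IsMSO φ
  | .allS _ φ => Fml.IsMSO φ
  | _ => False

/-- FO(RPR)-formulas: FO(<) extended with successor and relational primitive recursion. -/
def Fml.IsRPR : Fml → Prop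
  | .falsum => True
  | .atom _ _ => True
  | .lt _ _ => True
  | .eq _ _ => True
  | .succ _ _ => True
  | .qprev _ => True
  | .qapp _ _ => True
  | .neg φ => Fml.IsRPR φ
  | .and φ ψ => Fml.IsRPR φ ∧ Fml.IsRPR ψ
  | .or φ ψ => Fml.IsRPR φ ∧ Fml.IsRPR ψ
  | .ex _ φ => Fml.IsRPR φ
  | .all _ φ => Fml.IsRPR φ
  | .rpr n Θ _ ψ => (∀ j : Fin n, Fml.IsRPR (Θ j)) ∧ Fml.IsRPR ψ
  | _ => False

/-- MFO(<)-formulas: monadic first-order formulas built from atoms `A(t)`,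
`t < t'`, `t = t'` and `t = t' + 1`. -/
def Fml.IsMFO : Fml → Prop
  | .falsum => True
  | .atom _ _ => True
  | .lt _ _ => True
  | .eq _ _ => True
  | .succ _ _ => True
  | .neg φ => Fml.IsMFO φ
  | .and φ ψ => Fml.IsMFO φ ∧ Fml.IsMFO ψ
  | .or φ ψ => Fml.IsMFO φ ∧ Fml.IsMFO ψ
  | .ex _ φ => Fml.IsMFO φ
  | .all _ φ => Fml.IsMFO φ
  | _ => False

/-- Quasi-positive MFO(<)-formulas: built from atoms `A(t)`, `t < t'`, `t = t'`,
`t = t' + 1` (and ⊥) using ∧, ∨, ∃, ∀ as well as guarded universal quantification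
`∀y (x < y < z → φ)`, `∀y (x < y → φ)`, `∀y (y < z → φ)`
(the guarded implications are encoded via `¬guard ∨ φ`). -/
inductive Fml.IsQP : Fml → Prop
  | falsum : Fml.IsQP .falsum
  | atom (a x : ℕ) : Fml.IsQP (.atom a x)
  | lt (x y : ℕ) : Fml.IsQP (.lt x y)
  | eq (x y : ℕ) : Fml.IsQP (.eq x y)
  | succ (x y : ℕ) : Fml.IsQP (.succ x y)
  | and {φ ψ : Fml} : Fml.IsQP φ → Fml.IsQP ψ → Fml.IsQP (.and φ ψ)
  | or {φ ψ : Fml} : Fml.IsQP φ → Fml.IsQP ψ → Fml.IsQP (.or φ ψ)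
  | ex (x : ℕ) {φ : Fml} : Fml.IsQP φ → Fml.IsQP (.ex x φ)
  | all (x : ℕ) {φ : Fml} : Fml.IsQP φ → Fml.IsQP (.all x φ)
  | allBtw (y x z : ℕ) {φ : Fml} : Fml.IsQP φ →
      Fml.IsQP (.all y (.or (.neg (.and (.lt x y) (.lt y z))) φ))
  | allGt (y x : ℕ) {φ : Fml} : Fml.IsQP φ →
      Fml.IsQP (.all y (.or (.neg (.lt x y)) φ))
  | allLt (y z : ℕ) {φ : Fml} : Fml.IsQP φ →
      Fml.IsQP (.all y (.or (.neg (.lt y z)) φ))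

/-- Evaluation in a structure with domain `D` and unary predicates `I`
(no set variables, placeholders or relation variables supplied). -/
def Fml.evalIn (D : Set ℤ) (I : Itp) (φ : Fml) (env : ℕ → ℤ) : Prop :=
  Fml.eval D I φ env (fun _ => ∅) (fun _ => False) (fun _ _ => False)

/-- An MFO(<)-formula is monotone if it is preserved under adding time points
to the extensions of the atomic concepts. -/
def MonotoneFml (ψ : Fml) : Prop :=
  ∀ M₁ M₂ : Itp, (∀ a : ℕ, M₁ a ⊆ M₂ a) → ∀ env : ℕ → ℤ,
    Fml.evalIn Set.univ M₁ ψ env → Fml.evalIn Set.univ M₂ ψ env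

/-! ## The canonical model of a Horn ontology and a data instance -/

/-- Atoms of the closure: ⊥ or `C(n)` for a (basic) temporal concept `C` and `n ∈ ℤ`. -/
inductive EAtom : Type where
  | bot : EAtom
  | conc : TC → ℤ → EAtom

/-- One (non-recursive) application of the closure rules of the canonical model. -/
def clStep (O : Ontology) (Λ : Set EAtom) : Set EAtom :=
  Λ ∪
  {e | ∃ cl ∈ O, ∃ n : ℤ, (∀ C ∈ cl.prem, EAtom.conc C n ∈ Λ) ∧
        ((∃ C : TC, cl.concl = [C] ∧ e = EAtom.conc C n) ∨
          (cl.concl = [] ∧ e = EAtom.bot))} ∪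
  {e | ∃ C : TC, ∃ n k : ℤ, n < k ∧ EAtom.conc (.boxF C) n ∈ Λ ∧ e = EAtom.conc C k} ∪
  {e | ∃ C : TC, ∃ n : ℤ, (∀ k : ℤ, n < k → EAtom.conc C k ∈ Λ) ∧
        e = EAtom.conc (.boxF C) n} ∪
  {e | ∃ C : TC, ∃ n : ℤ, EAtom.conc (.nextF C) n ∈ Λ ∧ e = EAtom.conc C (n + 1)} ∪
  {e | ∃ C : TC, ∃ n : ℤ, EAtom.conc C (n + 1) ∈ Λ ∧ e = EAtom.conc (.nextF C) n} ∪
  {e | ∃ C : TC, ∃ n k : ℤ, k < n ∧ EAtom.conc (.boxP C) n ∈ Λ ∧ e = EAtom.conc C k} ∪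
  {e | ∃ C : TC, ∃ n : ℤ, (∀ k : ℤ, k < n → EAtom.conc C k ∈ Λ) ∧
        e = EAtom.conc (.boxP C) n} ∪
  {e | ∃ C : TC, ∃ n : ℤ, EAtom.conc (.nextP C) n ∈ Λ ∧ e = EAtom.conc C (n - 1)} ∪
  {e | ∃ C : TC, ∃ n : ℤ, EAtom.conc C (n - 1) ∈ Λ ∧ e = EAtom.conc (.nextP C) n}

/-- Transfinite iteration of the closure rules. -/
noncomputable def clIter (O : Ontology) (Λ : Set EAtom) (o : Ordinal.{0}) : Set EAtom :=
  Ordinal.limitRecOn o Λ (fun _ ih => clStep O ih)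
    (fun o _ ih => ⋃ (o' : Ordinal.{0}), ⋃ (h : o' < o), ih o' h)

/-- The atoms of a data instance, as a set of closure atoms. -/
def dataAtoms (A : DataInstance) : Set EAtom :=
  {e | ∃ p ∈ A.atoms, e = EAtom.conc (.atom p.1) p.2}

open Ordinal in
/-- The canonical model `C_{O,A}`: the closure of `A` under the rules,
iterated up to the first uncountable ordinal ω₁. -/
noncomputable def canon (O : Ontology) (A : DataInstance) : Set EAtom :=
  clIter O (dataAtoms A) (Ordinal.omega 1)

/-- The canonical model regarded as a temporal interpretation. -/
noncomputable def canonItp (O : Ontology) (A : DataInstance) : Itp :=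
  fun a => {n | EAtom.conc (.atom a) n ∈ canon O A}

/-- The type `τ_{O,A}(n)`: the set of subconcepts of `O` that hold at `n`
in the canonical model. -/
noncomputable def tau (O : Ontology) (A : DataInstance) (n : ℤ) : Set TC :=
  {C ∈ O.subs | n ∈ TC.sem (canonItp O A) C}

/-! ## Literals and the reachability relation ⇝ for Krom ontologies -/

/-- A simple literal: an atomic concept with a polarity. -/
abbrev Lit : Type := ℕ × Bool

/-- The temporal concept corresponding to a literal. -/
def Lit.toTC (L : Lit) : TC := if L.2 then .atom L.1 else .neg (.atom L.1)

def TC.iterF : ℕ → TC → TC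
  | 0, C => C
  | k + 1, C => .nextF (TC.iterF k C)

def TC.iterP : ℕ → TC → TC
  | 0, C => C
  | k + 1, C => .nextP (TC.iterP k C)

/-- `○^k C`: `k` occurrences of ○F if `k > 0`, of ○P if `k < 0`. -/
def TC.shift (k : ℤ) (C : TC) : TC :=
  if 0 ≤ k then TC.iterF k.toNat C else TC.iterP (-k).toNat C

/-- `(L₁,n₁) ⇝ (L₂,n₂)`: in every model of `O`,
`(○^{n₁} L₁)^M ⊆ (○^{n₂} L₂)^M`. -/
def leadsTo (O : Ontology) (L₁ : Lit) (n₁ : ℤ) (L₂ : Lit) (n₂ : ℤ) : Prop :=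
  ∀ M : Itp, (∀ cl ∈ O, cl.holds M) →
    TC.sem M (TC.shift n₁ L₁.toTC) ⊆ TC.sem M (TC.shift n₂ L₂.toTC)


/-! ## Finite conjunctions and disjunctions -/

/-- The disjunction of a list of formulas. -/
def Fml.disj : List Fml → Fml
  | [] => .falsum
  | φ :: l => .or φ (Fml.disj l)

/-- The conjunction of a list of formulas. -/
def Fml.conj : List Fml → Fml
  | [] => .neg .falsum
  | φ :: l => .and φ (Fml.conj l)

theorem Fml.eval_disj (D : Set ℤ) (I : Itp) (e : ℕ → ℤ) (s : ℕ → Set ℤ) (p : ℕ → Prop)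
    (Q : ℕ → ℤ → Prop) (l : List Fml) :
    Fml.eval D I (Fml.disj l) e s p Q ↔ ∃ φ ∈ l, Fml.eval D I φ e s p Q := by
  induction l with
  | nil => simp [Fml.disj, Fml.eval]
  | cons φ l ih => simp [Fml.disj, Fml.eval, ih]

theorem Fml.eval_conj (D : Set ℤ) (I : Itp) (e : ℕ → ℤ) (s : ℕ → Set ℤ) (p : ℕ → Prop)
    (Q : ℕ → ℤ → Prop) (l : List Fml) :
    Fml.eval D I (Fml.conj l) e s p Q ↔ ∀ φ ∈ l, Fml.eval D I φ e s p Q := by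
  induction l with
  | nil => simp [Fml.conj, Fml.eval]
  | cons φ l ih => simp [Fml.conj, Fml.eval, ih]

theorem Fml.IsMFO.disj {l : List Fml} (h : ∀ φ ∈ l, φ.IsMFO) : (Fml.disj l).IsMFO := by
  induction l with
  | nil => trivial
  | cons φ l ih => exact ⟨h φ (by simp), ih fun ψ hψ => h ψ (by simp [hψ])⟩

theorem Fml.IsMFO.conj {l : List Fml} (h : ∀ φ ∈ l, φ.IsMFO) : (Fml.conj l).IsMFO := by
  induction l with
  | nil => trivial
  | cons φ l ih => exact ⟨h φ (by simp), ih fun ψ hψ => h ψ (by simp [hψ])⟩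

theorem Fml.IsRPR.disj {l : List Fml} (h : ∀ φ ∈ l, φ.IsRPR) : (Fml.disj l).IsRPR := by
  induction l with
  | nil => trivial
  | cons φ l ih => exact ⟨h φ (by simp), ih fun ψ hψ => h ψ (by simp [hψ])⟩

theorem Fml.IsRPR.conj {l : List Fml} (h : ∀ φ ∈ l, φ.IsRPR) : (Fml.conj l).IsRPR := by
  induction l with
  | nil => trivial
  | cons φ l ih => exact ⟨h φ (by simp), ih fun ψ hψ => h ψ (by simp [hψ])⟩

theorem Fml.fvars_disj_subset {l : List Fml} {V : Set ℕ} (h : ∀ φ ∈ l, φ.fvars ⊆ V) :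
    (Fml.disj l).fvars ⊆ V := by
  induction l with
  | nil => simp [Fml.disj, Fml.fvars]
  | cons φ l ih =>
    exact Set.union_subset (h φ (by simp)) (ih fun ψ hψ => h ψ (by simp [hψ]))

theorem Fml.fvars_conj_subset {l : List Fml} {V : Set ℕ} (h : ∀ φ ∈ l, φ.fvars ⊆ V) :
    (Fml.conj l).fvars ⊆ V := by
  induction l with
  | nil => simp [Fml.conj, Fml.fvars]
  | cons φ l ih =>
    exact Set.union_subset (h φ (by simp)) (ih fun ψ hψ => h ψ (by simp [hψ]))

/-! ## Ontologies as monadic first-order sentences -/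

/-- The standard translation of a basic temporal concept, with free variable `0`. -/
def TC.toFml : TC → Fml
  | .atom a => .atom a 0
  | .nextF C => .ex 1 (.and (.succ 1 0) (.ex 0 (.and (.eq 0 1) C.toFml)))
  | .nextP C => .ex 1 (.and (.succ 0 1) (.ex 0 (.and (.eq 0 1) C.toFml)))
  | .boxF C => .all 1 (.or (.neg (.lt 0 1)) (.ex 0 (.and (.eq 0 1) C.toFml)))
  | .boxP C => .all 1 (.or (.neg (.lt 1 0)) (.ex 0 (.and (.eq 0 1) C.toFml)))
  | _ => .falsum

theorem TC.toFml_isMFO (C : TC) : C.toFml.IsMFO := by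
  induction C <;> simp_all [TC.toFml, Fml.IsMFO]

theorem TC.fvars_toFml (C : TC) : C.toFml.fvars ⊆ {0} := by
  induction C <;> simp [TC.toFml, Fml.fvars, Set.subset_def] <;> grind

theorem TC.IsBasic.eval_toFml {C : TC} (hC : C.IsBasic) (M : Itp) (e : ℕ → ℤ) (s : ℕ → Set ℤ)
    (p : ℕ → Prop) (Q : ℕ → ℤ → Prop) :
    Fml.eval Set.univ M C.toFml e s p Q ↔ e 0 ∈ C.sem M := by
  induction hC generalizing e with
  | atom a => simp [TC.toFml, Fml.eval, TC.sem]
  | nextF _ ih => simp [TC.toFml, Fml.eval, TC.sem, ih]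
  | nextP _ ih =>
    simp only [TC.toFml, Fml.eval, TC.sem, ih]
    simp [← sub_eq_iff_eq_add]
  | boxF _ ih => simp [TC.toFml, Fml.eval, TC.sem, ih, imp_iff_not_or]
  | boxP _ ih => simp [TC.toFml, Fml.eval, TC.sem, ih, imp_iff_not_or]

/-- A sentence expressing the truth of a clause. -/
def Clause.toFml (cl : Clause) : Fml :=
  .all 0 (.or (.neg (Fml.conj (cl.prem.map TC.toFml))) (Fml.disj (cl.concl.map TC.toFml)))

/-- A sentence expressing the truth of all clauses of an ontology. -/
def Ontology.toFml (O : Ontology) : Fml := Fml.conj (O.map Clause.toFml)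

theorem Ontology.toFml_isMFO (O : Ontology) : O.toFml.IsMFO := by
  refine Fml.IsMFO.conj fun φ hφ => ?_
  obtain ⟨cl, -, rfl⟩ := List.mem_map.1 hφ
  refine ⟨Fml.IsMFO.conj fun φ hφ => ?_, Fml.IsMFO.disj fun φ hφ => ?_⟩ <;>
  · obtain ⟨C, -, rfl⟩ := List.mem_map.1 hφ
    exact C.toFml_isMFO

theorem Ontology.fvars_toFml (O : Ontology) : O.toFml.fvars ⊆ ∅ := by
  refine Fml.fvars_conj_subset fun φ hφ => ?_
  obtain ⟨cl, -, rfl⟩ := List.mem_map.1 hφ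
  refine Set.sdiff_subset_iff.2 (Set.union_subset ?_ ?_)
  · refine Fml.fvars_conj_subset fun φ hφ => ?_
    obtain ⟨C, -, rfl⟩ := List.mem_map.1 hφ
    simpa using C.fvars_toFml
  · refine Fml.fvars_disj_subset fun φ hφ => ?_
    obtain ⟨C, -, rfl⟩ := List.mem_map.1 hφ
    simpa using C.fvars_toFml

theorem Ontology.BoolBoxNext.evalIn_toFml {O : Ontology} (hO : O.BoolBoxNext) (M : Itp)
    (e : ℕ → ℤ) : Fml.evalIn Set.univ M O.toFml e ↔ ∀ cl ∈ O, cl.holds M := by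
  simp only [Fml.evalIn, Ontology.toFml, Fml.eval_conj, List.forall_mem_map]
  refine forall₂_congr fun cl hcl => ?_
  simp only [Clause.toFml, Fml.eval, Fml.eval_conj, Fml.eval_disj, List.mem_map,
    forall_exists_index, and_imp, forall_apply_eq_imp_iff₂, exists_exists_and_eq_and, Set.mem_univ,
    true_implies, Clause.holds, ← imp_iff_not_or]
  refine forall_congr' fun n => imp_congr ?_ ?_
  · refine forall₂_congr fun C hC => ?_
    rw [((hO cl hcl).1 C hC).eval_toFml]; simp
  · refine exists_congr fun C => and_congr_right fun hC => ?_
    rw [((hO cl hcl).2 C hC).eval_toFml]; simp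

/-! ## Invariance of monadic first-order formulas -/

/-- The truth of an `MFO(<)`-formula over `ℤ` is invariant under shifts, and depends on finitely
many atomic concepts and on the values of the free variables only. -/
theorem Fml.IsMFO.exists_eval_congr {φ : Fml} (hφ : φ.IsMFO) (s : ℕ → Set ℤ) (p : ℕ → Prop)
    (Q : ℕ → ℤ → Prop) :
    ∃ K : ℕ, ∀ (M M' : Itp) (e e' : ℕ → ℤ) (c : ℤ), (∀ a < K, ∀ z, z ∈ M a ↔ z + c ∈ M' a) →
      (∀ x ∈ φ.fvars, e' x = e x + c) →
      (Fml.eval Set.univ M φ e s p Q ↔ Fml.eval Set.univ M' φ e' s p Q) := by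
  have update_add {V : Set ℕ} {x : ℕ} {e e' : ℕ → ℤ} {c : ℤ}
      (h : ∀ y ∈ V \ {x}, e' y = e y + c) (d : ℤ) :
      ∀ y ∈ V, Function.update e' x (d + c) y = Function.update e x d y + c := by
    intro y hy
    by_cases hyx : y = x
    · subst hyx; simp
    · simpa [hyx] using h y ⟨hy, hyx⟩
  induction φ with
  | falsum => exact ⟨0, fun _ _ _ _ _ _ _ => Iff.rfl⟩
  | atom a x =>
    refine ⟨a + 1, fun M M' e e' c h he => ?_⟩
    simp only [Fml.eval, he x (by simp [Fml.fvars])]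
    exact h a (by omega) _
  | lt x y =>
    refine ⟨0, fun M M' e e' c h he => ?_⟩
    simp [Fml.eval, he x (by simp [Fml.fvars]), he y (by simp [Fml.fvars])]
  | eq x y =>
    refine ⟨0, fun M M' e e' c h he => ?_⟩
    simp [Fml.eval, he x (by simp [Fml.fvars]), he y (by simp [Fml.fvars])]
  | succ x y =>
    refine ⟨0, fun M M' e e' c h he => ?_⟩
    simp only [Fml.eval, he x (by simp [Fml.fvars]), he y (by simp [Fml.fvars])]
    omega
  | neg φ ih =>
    obtain ⟨K, hK⟩ := ih hφ
    exact ⟨K, fun M M' e e' c h he => not_congr (hK M M' e e' c h he)⟩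
  | and φ ψ ih₁ ih₂ =>
    obtain ⟨K₁, h₁⟩ := ih₁ hφ.1
    obtain ⟨K₂, h₂⟩ := ih₂ hφ.2
    exact ⟨max K₁ K₂, fun M M' e e' c h he => and_congr
      (h₁ M M' e e' c (fun a ha => h a (by omega)) fun x hx => he x (Or.inl hx))
      (h₂ M M' e e' c (fun a ha => h a (by omega)) fun x hx => he x (Or.inr hx))⟩
  | or φ ψ ih₁ ih₂ =>
    obtain ⟨K₁, h₁⟩ := ih₁ hφ.1
    obtain ⟨K₂, h₂⟩ := ih₂ hφ.2
    exact ⟨max K₁ K₂, fun M M' e e' c h he => or_congr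
      (h₁ M M' e e' c (fun a ha => h a (by omega)) fun x hx => he x (Or.inl hx))
      (h₂ M M' e e' c (fun a ha => h a (by omega)) fun x hx => he x (Or.inr hx))⟩
  | ex x φ ih =>
    obtain ⟨K, hK⟩ := ih hφ
    refine ⟨K, fun M M' e e' c h he => ?_⟩
    simp only [Fml.eval, Set.mem_univ, true_and]
    exact (Equiv.addRight c).exists_congr fun d => hK M M' _ _ c h (update_add he d)
  | all x φ ih =>
    obtain ⟨K, hK⟩ := ih hφ
    refine ⟨K, fun M M' e e' c h he => ?_⟩
    simp only [Fml.eval, Set.mem_univ, true_implies]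
    exact (Equiv.addRight c).forall_congr fun d => hK M M' _ _ c h (update_add he d)
  | mod | svar | qprev | qapp | exS | allS | rpr => exact hφ.elim

/-! ## Finite left types -/

/-- The truth of `P` depends on the negative half of an interpretation and of an assignment to
the variables in `V` only through an invariant with finitely many values. -/
def LeftFinite (V : Set ℕ) (P : Itp → (ℕ → ℤ) → Prop) : Prop :=
  ∃ (F : Type) (_ : Finite F) (τ : Itp → (ℕ → ℤ) → F), ∀ (M M' : Itp) (e e' : ℕ → ℤ),
    (∀ a, ∀ z, 0 ≤ z → (z ∈ M a ↔ z ∈ M' a)) →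
    (∀ x ∈ V, max (e x) (-1) = max (e' x) (-1)) →
    τ (fun a => M a ∩ Set.Iio 0) (fun x => min (e x) 0) =
      τ (fun a => M' a ∩ Set.Iio 0) (fun x => min (e' x) 0) →
    (P M e ↔ P M' e')

theorem LeftFinite.of_iff {V : Set ℕ} {P P' : Itp → (ℕ → ℤ) → Prop} (h : LeftFinite V P)
    (hP : ∀ M e, P' M e ↔ P M e) : LeftFinite V P' := by
  rwa [show P' = P from funext₂ fun M e => propext (hP M e)]

theorem LeftFinite.not {V : Set ℕ} {P : Itp → (ℕ → ℤ) → Prop} (h : LeftFinite V P) :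
    LeftFinite V fun M e => ¬ P M e := by
  obtain ⟨F, hF, τ, hτ⟩ := h
  exact ⟨F, hF, τ, fun M M' e e' hM he h => not_congr (hτ M M' e e' hM he h)⟩

theorem LeftFinite.and {V W : Set ℕ} {P R : Itp → (ℕ → ℤ) → Prop} (hP : LeftFinite V P)
    (hR : LeftFinite W R) : LeftFinite (V ∪ W) fun M e => P M e ∧ R M e := by
  obtain ⟨F, hF, τ, hτ⟩ := hP
  obtain ⟨G, hG, σ, hσ⟩ := hR
  refine ⟨F × G, inferInstance, fun M e => (τ M e, σ M e), fun M M' e e' hM he h => ?_⟩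
  obtain ⟨h₁, h₂⟩ := Prod.mk.inj h
  exact and_congr (hτ M M' e e' hM (fun x hx => he x (Or.inl hx)) h₁)
    (hσ M M' e e' hM (fun x hx => he x (Or.inr hx)) h₂)

theorem LeftFinite.or {V W : Set ℕ} {P R : Itp → (ℕ → ℤ) → Prop} (hP : LeftFinite V P)
    (hR : LeftFinite W R) : LeftFinite (V ∪ W) fun M e => P M e ∨ R M e :=
  (hP.not.and hR.not).not.of_iff fun M e => by tauto

theorem LeftFinite.exists {V : Set ℕ} {P : Itp → (ℕ → ℤ) → Prop} (x : ℕ) (hP : LeftFinite V P) :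
    LeftFinite (V \ {x}) fun M e => ∃ d : ℤ, P M (Function.update e x d) := by
  obtain ⟨F, hF, τ, hτ⟩ := hP
  have min_update (e : ℕ → ℤ) (d : ℤ) : (fun y => min (Function.update e x d y) 0) =
      Function.update (fun y => min (e y) 0) x (min d 0) := by
    ext y
    by_cases h : y = x
    · subst h; simp
    · simp [h]
  refine ⟨Set F × F, inferInstance, fun M e =>
    ({f | ∃ d < 0, τ M (Function.update e x d) = f}, τ M (Function.update e x 0)), ?_⟩
  suffices H : ∀ (M M' : Itp) (e e' : ℕ → ℤ),
      (∀ a, ∀ z, 0 ≤ z → (z ∈ M a ↔ z ∈ M' a)) →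
      (∀ y ∈ V \ {x}, max (e y) (-1) = max (e' y) (-1)) →
      (({f | ∃ d < 0, τ (fun a => M a ∩ Set.Iio 0)
          (Function.update (fun y => min (e y) 0) x d) = f} : Set F),
        τ (fun a => M a ∩ Set.Iio 0) (Function.update (fun y => min (e y) 0) x 0)) =
      (({f | ∃ d < 0, τ (fun a => M' a ∩ Set.Iio 0)
          (Function.update (fun y => min (e' y) 0) x d) = f} : Set F),
        τ (fun a => M' a ∩ Set.Iio 0) (Function.update (fun y => min (e' y) 0) x 0)) →
      (∃ d : ℤ, P M (Function.update e x d)) → ∃ d : ℤ, P M' (Function.update e' x d) from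
    fun M M' e e' hM he h => ⟨H M M' e e' hM he h, H M' M e' e
      (fun a z hz => (hM a z hz).symm) (fun y hy => (he y hy).symm) h.symm⟩
  rintro M M' e e' hM he h ⟨d, hd⟩
  obtain ⟨h₁, h₂⟩ := Prod.mk.inj h
  have agree {d d' : ℤ} (hdd : max d (-1) = max d' (-1)) (y : ℕ) (hy : y ∈ V) :
      max (Function.update e x d y) (-1) = max (Function.update e' x d' y) (-1) := by
    by_cases hyx : y = x
    · subst hyx; simpa using hdd
    · simpa [hyx] using he y ⟨hy, hyx⟩
  rcases lt_or_ge d 0 with hneg | hpos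
  · obtain ⟨d', hd', hτd⟩ := (Set.ext_iff.1 h₁ _).1 ⟨d, hneg, rfl⟩
    refine ⟨d', (hτ M M' _ _ hM (agree (by omega)) ?_).1 hd⟩
    rw [min_update, min_update, min_eq_left hneg.le, min_eq_left hd'.le, hτd]
  · refine ⟨d, (hτ M M' _ _ hM (agree rfl) ?_).1 hd⟩
    rw [min_update, min_update, min_eq_right hpos, h₂]

theorem LeftFinite.forall {V : Set ℕ} {P : Itp → (ℕ → ℤ) → Prop} (x : ℕ) (hP : LeftFinite V P) :
    LeftFinite (V \ {x}) fun M e => ∀ d : ℤ, P M (Function.update e x d) :=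
  (hP.not.exists x).not.of_iff fun M e => by simp

theorem Fml.IsMFO.leftFinite {φ : Fml} (hφ : φ.IsMFO) (s : ℕ → Set ℤ) (p : ℕ → Prop)
    (Q : ℕ → ℤ → Prop) :
    LeftFinite φ.fvars fun M e => Fml.eval Set.univ M φ e s p Q := by
  induction φ with
  | falsum => exact ⟨Unit, inferInstance, fun _ _ => (), fun _ _ _ _ _ _ _ => Iff.rfl⟩
  | atom a x =>
    refine ⟨Prop, inferInstance, fun M e => e x ∈ M a, fun M M' e e' hM he h => ?_⟩
    have hx := he x (by simp [Fml.fvars])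
    simp only [Fml.eval]
    rcases lt_or_ge (e x) 0 with hneg | hpos
    · have hneg' : e' x < 0 := by omega
      simpa [min_eq_left hneg.le, min_eq_left hneg'.le, hneg, hneg'] using h
    · rw [show e' x = e x by omega]
      exact hM a _ hpos
  | lt x y =>
    refine ⟨Prop, inferInstance, fun M e => e x < e y, fun M M' e e' hM he h => ?_⟩
    have hx := he x (by simp [Fml.fvars])
    have hy := he y (by simp [Fml.fvars])
    simp only [eq_iff_iff] at h
    simp only [Fml.eval]
    omega
  | eq x y =>
    refine ⟨Prop, inferInstance, fun M e => e x = e y, fun M M' e e' hM he h => ?_⟩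
    have hx := he x (by simp [Fml.fvars])
    have hy := he y (by simp [Fml.fvars])
    simp only [eq_iff_iff] at h
    simp only [Fml.eval]
    omega
  | succ x y =>
    refine ⟨Prop, inferInstance, fun M e => e x = e y + 1, fun M M' e e' hM he h => ?_⟩
    have hx := he x (by simp [Fml.fvars])
    have hy := he y (by simp [Fml.fvars])
    simp only [eq_iff_iff] at h
    simp only [Fml.eval]
    omega
  | neg φ ih => exact (ih hφ).not
  | and φ ψ ih₁ ih₂ => exact (ih₁ hφ.1).and (ih₂ hφ.2)
  | or φ ψ ih₁ ih₂ => exact (ih₁ hφ.1).or (ih₂ hφ.2)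
  | ex x φ ih => exact ((ih hφ).exists x).of_iff fun M e => by simp [Fml.eval]
  | all x φ ih => exact ((ih hφ).forall x).of_iff fun M e => by simp [Fml.eval]
  | mod | svar | qprev | qapp | exS | allS | rpr => exact hφ.elim

/-! ## The language of expandable words -/

/-- A letter records which of the first `K` atomic concepts are asserted at a position and which
of the first `m` variables denote it. -/
abbrev Letter (K m : ℕ) : Type := (Fin K → Prop) × (Fin m → Prop)

/-- The word `w`, placed at position `c`, is compatible with an interpretation and an
assignment. -/
def Fits {K m : ℕ} (w : List (Letter K m)) (c : ℤ) (M : Itp) (e : ℕ → ℤ) : Prop :=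
  ∀ (i : ℕ) (h : i < w.length),
    (∀ a : Fin K, w[i].1 a → c + i ∈ M a) ∧ ∀ j : Fin m, w[i].2 j ↔ e j = c + i

theorem fits_append {K m : ℕ} (w u : List (Letter K m)) (c : ℤ) (M : Itp) (e : ℕ → ℤ) :
    Fits (w ++ u) c M e ↔ Fits w c M e ∧ Fits u (c + w.length) M e := by
  constructor
  · refine fun h => ⟨fun i hi => ?_, fun i hi => ?_⟩
    · have := h i (by simp; omega)
      rwa [List.getElem_append_left hi] at this
    · have := h (w.length + i) (by simp; omega)
      simpa [add_assoc] using this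
  · rintro ⟨h₁, h₂⟩ i hi
    rcases lt_or_ge i w.length with hw | hw
    · rw [List.getElem_append_left hw]
      exact h₁ i hw
    · have := h₂ (i - w.length) (by simp at hi; omega)
      rw [List.getElem_append_right hw]
      simpa [add_assoc, Nat.cast_sub hw] using this

/-- The words that some interpretation and assignment satisfying `χ` are compatible with. -/
def expandable (K m : ℕ) (χ : Fml) : Language (Letter K m) :=
  {w | ∃ (c : ℤ) (M : Itp) (e : ℕ → ℤ), Fits w c M e ∧ Fml.evalIn Set.univ M χ e}

theorem exists_fits_of_mem_expandable {K m : ℕ} {χ : Fml} (hχ : χ.IsMFO)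
    {w : List (Letter K m)} (hw : w ∈ expandable K m χ) (c : ℤ) :
    ∃ (M : Itp) (e : ℕ → ℤ), Fits w c M e ∧ Fml.evalIn Set.univ M χ e := by
  obtain ⟨c', M, e, hfit, hev⟩ := hw
  obtain ⟨_, hK⟩ := hχ.exists_eval_congr (fun _ => ∅) (fun _ => False) (fun _ _ => False)
  refine ⟨fun a => {z | z + (c' - c) ∈ M a}, fun x => e x - (c' - c), fun i hi => ?_,
    (hK _ M _ e (c' - c) (fun _ _ _ => Iff.rfl) fun x _ => by ring).2 hev⟩
  obtain ⟨h₁, h₂⟩ := hfit i hi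
  refine ⟨fun a ha => ?_, fun j => (h₂ j).trans (by constructor <;> intro _ <;> linarith)⟩
  have := h₁ a ha
  rwa [Set.mem_ofPred_eq, show c + i + (c' - c) = c' + i by ring]

theorem isRegular_expandable (K m : ℕ) {χ : Fml} (hχ : χ.IsMFO) (hfv : χ.fvars ⊆ {i | i < m}) :
    (expandable K m χ).IsRegular := by
  obtain ⟨F, hF, τ, hτ⟩ := hχ.leftFinite (fun _ => ∅) (fun _ => False) (fun _ _ => False)
  let T : List (Letter K m) → Set (F × (Fin m → Prop)) := fun w =>
    {q | ∃ (M : Itp) (e : ℕ → ℤ), Fits w (-w.length) M e ∧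
      q = (τ (fun a => M a ∩ Set.Iio 0) (fun x => min (e x) 0), fun j : Fin m => e j < 0)}
  have key : ∀ w w', T w = T w' → ∀ u, w ++ u ∈ expandable K m χ → w' ++ u ∈ expandable K m χ := by
    intro w w' hT u hu
    obtain ⟨M, e, hfit, hev⟩ := exists_fits_of_mem_expandable hχ hu (-w.length)
    rw [fits_append, neg_add_cancel] at hfit
    obtain ⟨M₁, e₁, hfit₁, heq⟩ := (Set.ext_iff.1 hT _).1 ⟨M, e, hfit.1, rfl⟩
    obtain ⟨hτ₁, hsgn⟩ := Prod.mk.inj heq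
    have hsgn (j : Fin m) : e j < 0 ↔ e₁ j < 0 := iff_of_eq (congrFun hsgn j)
    let M' : Itp := fun a => {z | (0 ≤ z ∧ z ∈ M a) ∨ (z < 0 ∧ z ∈ M₁ a)}
    let e' : ℕ → ℤ := fun x => if e₁ x < 0 then e₁ x else max (e x) 0
    refine ⟨-w'.length, M', e', ?_, ?_⟩
    · rw [fits_append, neg_add_cancel]
      refine ⟨fun i hi => ⟨fun a ha => ?_, fun j => ((hfit₁ i hi).2 j).trans ?_⟩,
        fun i hi => ⟨fun a ha => ?_, fun j => ((hfit.2 i hi).2 j).trans ?_⟩⟩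
      · exact Or.inr ⟨by omega, (hfit₁ i hi).1 a ha⟩
      · simp only [e']
        split_ifs <;> omega
      · exact Or.inl ⟨by omega, (hfit.2 i hi).1 a ha⟩
      · have := hsgn j
        simp only [e']
        split_ifs <;> omega
    · refine (hτ M M' e e' (fun a z hz => ?_) (fun x hx => ?_) ?_).1 hev
      · simp [M', hz, not_lt.2 hz]
      · have := hsgn ⟨x, hfv hx⟩
        simp only [e'] at *
        split_ifs <;> omega
      · rw [hτ₁]
        congr 1
        · ext a z
          simp only [M', Set.mem_inter_iff, Set.mem_ofPred_eq, Set.mem_Iio]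
          constructor
          · exact fun h => ⟨Or.inr ⟨h.2, h.1⟩, h.2⟩
          · rintro ⟨h | h, hz⟩
            · omega
            · exact ⟨h.2, hz⟩
        · ext x
          simp only [e']
          split_ifs <;> omega
  have hfac : (expandable K m χ).leftQuotient.FactorsThrough T := fun w w' h =>
    Set.ext fun u => ⟨key w w' h u, key w' w h.symm u⟩
  rw [Language.isRegular_iff_finite_range_leftQuotient, ← hfac.extend_comp fun _ => 0]
  exact (Set.finite_range (Function.extend T _ _)).subset (Set.range_comp_subset_range _ _)

/-! ## Simulating automata by relational primitive recursion -/

open Classical in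
/-- `φ` or its negation, according to the truth value of `b`. -/
noncomputable def Fml.literal (b : Prop) (φ : Fml) : Fml := if b then φ else .neg φ

theorem Fml.eval_literal (D : Set ℤ) (I : Itp) (e : ℕ → ℤ) (s : ℕ → Set ℤ) (p : ℕ → Prop)
    (Q : ℕ → ℤ → Prop) (b : Prop) (φ : Fml) :
    Fml.eval D I (Fml.literal b φ) e s p Q ↔ (Fml.eval D I φ e s p Q ↔ b) := by
  unfold Fml.literal
  split_ifs with h <;> simp [h, Fml.eval]

theorem Fml.isRPR_literal (b : Prop) (φ : Fml) : (Fml.literal b φ).IsRPR ↔ φ.IsRPR := by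
  unfold Fml.literal
  split_ifs <;> rfl

theorem Fml.fvars_literal (b : Prop) (φ : Fml) : (Fml.literal b φ).fvars = φ.fvars := by
  unfold Fml.literal
  split_ifs <;> rfl

/-- The letter found at position `k`. -/
def letterAt (K m : ℕ) (I : Itp) (e : ℕ → ℤ) (k : ℕ) : Letter K m :=
  (fun a => (k : ℤ) ∈ I a, fun j => e j = k)

/-- The word formed by the first `n` positions. -/
def prefixWord (K m : ℕ) (I : Itp) (e : ℕ → ℤ) (n : ℕ) : List (Letter K m) :=
  (List.range n).map (letterAt K m I e)

/-- The position denoted by the variable `m` carries the letter `α`. -/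
noncomputable def letterFml {K m : ℕ} (α : Letter K m) : Fml :=
  .and (Fml.conj ((List.finRange K).map fun a => Fml.literal (α.1 a) (.atom a m)))
    (Fml.conj ((List.finRange m).map fun j => Fml.literal (α.2 j) (.eq j m)))

theorem eval_letterFml {K m : ℕ} (α : Letter K m) (D : Set ℤ) (I : Itp) (e : ℕ → ℤ)
    (s : ℕ → Set ℤ) (p : ℕ → Prop) (Q : ℕ → ℤ → Prop) (k : ℕ) (hk : e m = k) :
    Fml.eval D I (letterFml α) e s p Q ↔ letterAt K m I e k = α := by
  simp [letterFml, Fml.eval, Fml.eval_conj, Fml.eval_literal, letterAt, Prod.ext_iff,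
    funext_iff, hk]

theorem isRPR_letterFml {K m : ℕ} (α : Letter K m) : (letterFml α).IsRPR := by
  refine ⟨Fml.IsRPR.conj fun φ hφ => ?_, Fml.IsRPR.conj fun φ hφ => ?_⟩ <;>
  · obtain ⟨i, -, rfl⟩ := List.mem_map.1 hφ
    rw [Fml.isRPR_literal]
    trivial

theorem fvars_letterFml {K m : ℕ} (α : Letter K m) : (letterFml α).fvars ⊆ {i | i ≤ m} := by
  refine Set.union_subset (Fml.fvars_conj_subset fun φ hφ => ?_)
    (Fml.fvars_conj_subset fun φ hφ => ?_) <;>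
  · obtain ⟨i, -, rfl⟩ := List.mem_map.1 hφ
    rw [Fml.fvars_literal]
    intro x
    simp only [Fml.fvars, Set.mem_insert_iff, Set.mem_singleton_iff, Set.mem_ofPred_eq]
    omega

/-- The automaton is in state `j` after reading the current letter. The placeholders are all
false exactly at the first position. -/
noncomputable def stepFml {K m n : ℕ} (B : DFA (Letter K m) (Fin n)) (j : Fin n) : Fml :=
  Fml.disj ((Finset.univ : Finset (Letter K m)).toList.map fun α => .and (letterFml α)
    (.or (Fml.disj ((List.finRange n).map fun i : Fin n =>
        .and (.qprev i) (Fml.literal (B.step i α = j) (.neg .falsum))))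
      (.and (Fml.conj ((List.finRange n).map fun i : Fin n => .neg (.qprev i)))
        (Fml.literal (B.step B.start α = j) (.neg .falsum)))))

theorem eval_stepFml {K m n : ℕ} (B : DFA (Letter K m) (Fin n)) (j : Fin n) (D : Set ℤ) (I : Itp)
    (e : ℕ → ℤ) (s : ℕ → Set ℤ) (p : ℕ → Prop) (Q : ℕ → ℤ → Prop) (k : ℕ) (hk : e m = k) :
    Fml.eval D I (stepFml B j) e s p Q ↔
      (∃ i : Fin n, p i ∧ B.step i (letterAt K m I e k) = j) ∨
        (∀ i : Fin n, ¬ p i) ∧ B.step B.start (letterAt K m I e k) = j := by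
  simp [-Prod.exists, stepFml, Fml.eval_disj, Fml.eval_conj, Fml.eval,
    eval_letterFml _ D I e s p Q k hk, Fml.eval_literal]

theorem isRPR_stepFml {K m n : ℕ} (B : DFA (Letter K m) (Fin n)) (j : Fin n) :
    (stepFml B j).IsRPR := by
  refine Fml.IsRPR.disj fun φ hφ => ?_
  obtain ⟨α, -, rfl⟩ := List.mem_map.1 hφ
  refine ⟨isRPR_letterFml α, Fml.IsRPR.disj fun φ hφ => ?_, Fml.IsRPR.conj fun φ hφ => ?_, ?_⟩
  · obtain ⟨i, -, rfl⟩ := List.mem_map.1 hφ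
    exact ⟨trivial, (Fml.isRPR_literal _ _).2 trivial⟩
  · obtain ⟨i, -, rfl⟩ := List.mem_map.1 hφ
    trivial
  · exact (Fml.isRPR_literal _ _).2 trivial

theorem fvars_stepFml {K m n : ℕ} (B : DFA (Letter K m) (Fin n)) (j : Fin n) :
    (stepFml B j).fvars ⊆ {i | i ≤ m} := by
  refine Fml.fvars_disj_subset fun φ hφ => ?_
  obtain ⟨α, -, rfl⟩ := List.mem_map.1 hφ
  refine Set.union_subset (fvars_letterFml α) (Set.union_subset
    (Fml.fvars_disj_subset fun φ hφ => ?_)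
    (Set.union_subset (Fml.fvars_conj_subset fun φ hφ => ?_) ?_))
  · obtain ⟨i, -, rfl⟩ := List.mem_map.1 hφ
    simp [Fml.fvars, Fml.fvars_literal]
  · obtain ⟨i, -, rfl⟩ := List.mem_map.1 hφ
    simp [Fml.fvars]
  · simp [Fml.fvars, Fml.fvars_literal]

open Classical in
/-- The automaton accepts the word formed by the whole domain. -/
noncomputable def acceptFml {K m n : ℕ} (B : DFA (Letter K m) (Fin n)) : Fml :=
  .rpr n (stepFml B) m (.ex m (.and (.all (m + 1) (.neg (.lt m (m + 1))))
    (Fml.disj (((List.finRange n).filter fun j => j ∈ B.accept).map fun j : Fin n =>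
      .qapp j m))))

theorem isRPR_acceptFml {K m n : ℕ} (B : DFA (Letter K m) (Fin n)) : (acceptFml B).IsRPR := by
  refine ⟨isRPR_stepFml B, trivial, Fml.IsRPR.disj fun φ hφ => ?_⟩
  obtain ⟨i, -, rfl⟩ := List.mem_map.1 hφ
  trivial

theorem fvars_acceptFml {K m n : ℕ} (B : DFA (Letter K m) (Fin n)) :
    (acceptFml B).fvars ⊆ {i | i < m} := by
  refine Set.union_subset (Set.iUnion_subset fun j x hx => ?_)
    (Set.sdiff_subset_iff.2 (Set.union_subset ?_ (Fml.fvars_disj_subset fun φ hφ => ?_)))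
  · exact lt_of_le_of_ne (fvars_stepFml B j hx.1) hx.2
  · intro x
    simp only [Fml.fvars, Set.mem_sdiff, Set.mem_insert_iff, Set.mem_singleton_iff, Set.mem_union]
    tauto
  · obtain ⟨i, -, rfl⟩ := List.mem_map.1 hφ
    exact Set.subset_union_left

theorem evalIn_acceptFml {K m n : ℕ} (B : DFA (Letter K m) (Fin n)) (N : ℕ) (I : Itp)
    (e : ℕ → ℤ) :
    Fml.evalIn (Set.Icc 0 (N : ℤ)) I (acceptFml B) e ↔ prefixWord K m I e (N + 1) ∈ B.accepts := by
  have letterAt_update (k : ℕ) (d : ℤ) :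
      letterAt K m I (Function.update e m d) k = letterAt K m I e k := by
    have hj (j : Fin m) : (j : ℕ) ≠ m := j.2.ne
    simp [letterAt, hj]
  have word_succ (k : ℕ) : prefixWord K m I e (k + 1) =
      prefixWord K m I e k ++ [letterAt K m I e k] := by
    simp [prefixWord, List.range_succ]
  let recQ : ℕ → Fin n → Prop := fun k =>
    Nat.rec (fun j => Fml.eval (Set.Icc 0 (N : ℤ)) I (stepFml B j) (Function.update e m 0)
        (fun _ => ∅) (fun _ => False) (fun _ _ => False))
      (fun l ih j => Fml.eval (Set.Icc 0 (N : ℤ)) I (stepFml B j)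
        (Function.update e m ((l : ℤ) + 1)) (fun _ => ∅) (fun i => ∃ h : i < n, ih ⟨i, h⟩)
        (fun _ _ => False)) k
  have hrec (k : ℕ) (j : Fin n) : recQ k j ↔ B.eval (prefixWord K m I e (k + 1)) = j := by
    induction k generalizing j with
    | zero =>
      change Fml.eval (Set.Icc 0 (N : ℤ)) I (stepFml B j) (Function.update e m 0)
        (fun _ => ∅) (fun _ => False) (fun _ _ => False) ↔ _
      rw [eval_stepFml B j _ _ _ _ _ _ 0 (by simp), letterAt_update, word_succ]
      simp [prefixWord]
    | succ k ih =>
      change Fml.eval (Set.Icc 0 (N : ℤ)) I (stepFml B j) (Function.update e m ((k : ℤ) + 1))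
        (fun _ => ∅) (fun i => ∃ h : i < n, recQ k ⟨i, h⟩) (fun _ _ => False) ↔ _
      rw [eval_stepFml B j _ _ _ _ _ _ (k + 1) (by simp), letterAt_update, word_succ (k + 1),
        DFA.eval_append_singleton]
      simp [ih]
  have hlast (d : ℤ) : (d ∈ Set.Icc 0 (N : ℤ) ∧ ∀ d' ∈ Set.Icc 0 (N : ℤ), ¬ d < d') ↔ d = N := by
    simp only [Set.mem_Icc]
    refine ⟨fun h => ?_, by rintro rfl; exact ⟨by omega, fun d' hd' => by omega⟩⟩
    have := h.2 N (by omega)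
    omega
  change (∃ d ∈ Set.Icc 0 (N : ℤ), (∀ d' ∈ Set.Icc 0 (N : ℤ),
    ¬ Function.update (Function.update e m d) (m + 1) d' m <
      Function.update (Function.update e m d) (m + 1) d' (m + 1)) ∧
    Fml.eval _ _ (Fml.disj _) _ _ _ (fun j z => ∃ h : j < n, 0 ≤ z ∧ recQ z.toNat ⟨j, h⟩)) ↔ _
  simp only [Function.update_self, Function.update_of_ne (Nat.lt_succ_self m).ne]
  simp only [← and_assoc, hlast, exists_eq_left, Fml.eval_disj, List.mem_map,
    exists_exists_and_eq_and, Fml.eval]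
  simp [hrec, DFA.mem_accepts]

/-! ## Data instances -/

theorem DataInstance.minT_eq_zero (A : DataInstance) : A.minT = 0 := by
  obtain ⟨p, hp, hp0⟩ := A.has_zero
  refine le_antisymm ((Finset.min'_le _ _ (Finset.mem_image_of_mem _ hp)).trans_eq hp0) ?_
  refine Finset.le_min' _ _ _ fun z hz => ?_
  obtain ⟨q, hq, rfl⟩ := Finset.mem_image.1 hz
  exact A.nonneg q hq

theorem DataInstance.tem_eq (A : DataInstance) : A.tem = Set.Icc 0 (A.maxT.toNat : ℤ) := by
  have h : A.minT ≤ A.maxT := Finset.min'_le_max' _ _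
  rw [A.minT_eq_zero] at h
  rw [DataInstance.tem, A.minT_eq_zero, Int.toNat_of_nonneg h]

theorem DataInstance.mem_tem (A : DataInstance) {p : ℕ × ℤ} (hp : p ∈ A.atoms) : p.2 ∈ A.tem :=
  ⟨Finset.min'_le _ _ (Finset.mem_image_of_mem _ hp),
    Finset.le_max' _ _ (Finset.mem_image_of_mem _ hp)⟩

/-- For large enough `K`, the word of a data instance is expandable if and only if `χ` is
satisfied in an interpretation containing the data. -/
theorem exists_prefixWord_mem_expandable_iff {m : ℕ} {χ : Fml} (hχ : χ.IsMFO)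
    (hfv : χ.fvars ⊆ {i | i < m}) :
    ∃ K : ℕ, ∀ (A : DataInstance) (e : ℕ → ℤ), (∀ i < m, e i ∈ A.tem) →
      (prefixWord K m A.itp e (A.maxT.toNat + 1) ∈ expandable K m χ ↔
        ∃ M : Itp, (∀ p ∈ A.atoms, p.2 ∈ M p.1) ∧ Fml.evalIn Set.univ M χ e) := by
  obtain ⟨K, hK⟩ := hχ.exists_eval_congr (fun _ => ∅) (fun _ => False) (fun _ _ => False)
  refine ⟨K, fun A e he => ⟨fun hw => ?_, ?_⟩⟩
  · obtain ⟨M, e', hfit, hev⟩ := exists_fits_of_mem_expandable hχ hw 0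
    have hfit (i : ℕ) (hi : i < A.maxT.toNat + 1) :
        (∀ a : Fin K, (a.1, (i : ℤ)) ∈ A.atoms → (i : ℤ) ∈ M a) ∧
          ∀ j : Fin m, e j = i ↔ e' j = i := by
      simpa [prefixWord, letterAt, DataInstance.itp] using
        hfit i (by simpa [prefixWord] using hi)
    refine ⟨fun a => {z | a < K → z ∈ M a}, fun p hp hpK => ?_,
      (hK M _ e' e 0 (fun a ha z => by simp [ha]) fun x hx => ?_).1 hev⟩
    · have hmem := A.mem_tem hp
      rw [A.tem_eq, Set.mem_Icc] at hmem
      have := (hfit p.2.toNat (by omega)).1 ⟨p.1, hpK⟩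
      rw [Int.toNat_of_nonneg hmem.1] at this
      exact this hp
    · have hmem := he x (hfv hx)
      rw [A.tem_eq, Set.mem_Icc] at hmem
      have := (hfit (e x).toNat (by omega)).2 ⟨x, hfv hx⟩
      rw [Int.toNat_of_nonneg hmem.1] at this
      simpa using (this.1 rfl).symm
  · rintro ⟨M, hM, hev⟩
    refine ⟨0, M, e, fun i hi => ⟨fun a ha => ?_, fun j => ?_⟩, hev⟩
    · rw [zero_add]
      refine hM (a.1, (i : ℤ)) ?_
      simpa [prefixWord, letterAt, DataInstance.itp] using ha
    · simp [prefixWord, letterAt]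

/-- FO(RPR)-rewritability of LTL_bool^□○ OMQs with
MFO(<)-queries of arbitrary arity `m`; the answer variables are `0, …, m-1`. -/
theorem boolBoxNext_MFO_OMQ_FORPR_rewritable (O : Ontology) (hO : O.BoolBoxNext)
    (m : ℕ) (ψ : Fml) (hψ : ψ.IsMFO) (hfv : ψ.fvars ⊆ {i | i < m}) :
    ∃ φ : Fml, φ.IsRPR ∧ φ.fvars ⊆ {i | i < m} ∧
      ∀ A : DataInstance, ∀ ℓ : ℕ → ℤ, (∀ i < m, ℓ i ∈ A.tem) →
        ((∀ M : Itp, IsModel M O A → Fml.evalIn Set.univ M ψ ℓ) ↔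
          Fml.evalIn A.tem A.itp φ ℓ) := by
  have hχ : (Fml.and O.toFml (.neg ψ)).IsMFO := ⟨O.toFml_isMFO, hψ⟩
  have hfvχ : (Fml.and O.toFml (.neg ψ)).fvars ⊆ {i | i < m} :=
    Set.union_subset (O.fvars_toFml.trans (Set.empty_subset _)) hfv
  obtain ⟨K, hK⟩ := exists_prefixWord_mem_expandable_iff hχ hfvχ
  obtain ⟨σ, _, B, hB⟩ := isRegular_expandable K m hχ hfvχ
  let B' : DFA (Letter K m) (Fin (Fintype.card σ)) := DFA.reindex (Fintype.equivFin σ) B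
  refine ⟨.neg (acceptFml B'), isRPR_acceptFml B', fvars_acceptFml B', fun A ℓ hℓ => ?_⟩
  change _ ↔ ¬ Fml.evalIn A.tem A.itp (acceptFml B') ℓ
  rw [A.tem_eq, evalIn_acceptFml, DFA.accepts_reindex, hB, hK A ℓ hℓ]
  push Not
  refine forall_congr' fun M => ?_
  have hev : Fml.evalIn Set.univ M (.and O.toFml (.neg ψ)) ℓ ↔
      (∀ cl ∈ O, cl.holds M) ∧ ¬ Fml.evalIn Set.univ M ψ ℓ :=
    and_congr (hO.evalIn_toFml M ℓ) Iff.rfl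
  rw [hev, IsModel]
  tauto

end LTLOMQ
end

section
/- Let O = {○P A → B, ○P B → A} and let q = (O, A) be the ontology-mediated atomic query with answer concept A. Then q is not FO(<)-rewritable: there is no constant-free FO(<)-formula q(t) with one free variable t such that ans(q, A) = {ℓ ∈ tem(A) : S_A ⊨ q(ℓ)} for every data instance A. -/
namespace LTLOMQ

/-- The ontology `O = {○P A → B, ○P B → A}`, with `A` the atomic concept `0`
and `B` the atomic concept `1`. -/
def evenOddOntology : Ontology :=
  [⟨[.nextP (.atom 0)], [.atom 1]⟩, ⟨[.nextP (.atom 1)], [.atom 0]⟩]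

/-! ## The data instance `{A(0), C(n)}` -/

/-- The data instance `{A(0), C(n)}`, with `C` the atomic concept `2`. -/
def endpointInstance (n : ℤ) (hn : 1 ≤ n) : DataInstance where
  atoms := {(0, 0), (2, n)}
  nonneg := by
    intro p hp
    simp only [Finset.mem_insert, Finset.mem_singleton] at hp
    rcases hp with rfl | rfl
    · exact le_rfl
    · exact le_trans zero_le_one hn
  has_zero := ⟨(0, 0), by simp, rfl⟩
  has_one := ⟨(2, n), by simp, hn⟩

theorem mem_endpointInstance_itp {n : ℤ} {hn : 1 ≤ n} {a : ℕ} {z : ℤ} :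
    z ∈ (endpointInstance n hn).itp a ↔ (a = 0 ∧ z = 0) ∨ (a = 2 ∧ z = n) := by
  simp [endpointInstance, DataInstance.itp]

theorem endpointInstance_tem {n : ℤ} (hn : 1 ≤ n) :
    (endpointInstance n hn).tem = Set.Icc 0 n := by
  have h0 : (0 : ℤ) ≤ n := by omega
  have hmin : (endpointInstance n hn).minT = 0 := by
    simp only [DataInstance.minT]
    refine (Finset.min'_eq_iff _ _ _).2 ⟨?_, ?_⟩ <;> simp [endpointInstance, h0]
  have hmax : (endpointInstance n hn).maxT = n := by
    simp only [DataInstance.maxT]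
    refine (Finset.max'_eq_iff _ _ _).2 ⟨?_, ?_⟩ <;> simp [endpointInstance, h0]
  rw [DataInstance.tem, hmin, hmax]

/-! ## Certain answers of the query on these instances -/

theorem even_mem_of_models_evenOdd {M : Itp} (hM : ∀ cl ∈ evenOddOntology, cl.holds M)
    (h0 : (0 : ℤ) ∈ M 0) (k : ℕ) : (2 * k : ℤ) ∈ M 0 := by
  have hAB : ∀ z : ℤ, z - 1 ∈ M 0 → z ∈ M 1 := by
    intro z hz
    simpa [TC.sem] using
      hM ⟨[.nextP (.atom 0)], [.atom 1]⟩ (by simp [evenOddOntology]) z (by simpa [TC.sem] using hz)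
  have hBA : ∀ z : ℤ, z - 1 ∈ M 1 → z ∈ M 0 := by
    intro z hz
    simpa [TC.sem] using
      hM ⟨[.nextP (.atom 1)], [.atom 0]⟩ (by simp [evenOddOntology]) z (by simpa [TC.sem] using hz)
  induction k with
  | zero => simpa using h0
  | succ k ih =>
    refine hBA _ (hAB _ ?_)
    convert ih using 1
    push_cast
    ring

/-- The interpretation in which `A` holds at the even and `B` at the odd time points. -/
def parityItp : Itp := fun a => {z | (a = 0 → Even z) ∧ (a = 1 → Odd z)}

theorem parityItp_isModel {n : ℤ} (hn : 1 ≤ n) :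
    IsModel parityItp evenOddOntology (endpointInstance n hn) := by
  constructor
  · intro cl hcl z hz
    simp only [evenOddOntology, List.mem_cons, List.not_mem_nil, or_false] at hcl
    rcases hcl with rfl | rfl <;>
      simpa [TC.sem, parityItp, Int.even_sub_one, ← Int.not_even_iff_odd] using hz
  · intro p hp
    simp only [endpointInstance, Finset.mem_insert, Finset.mem_singleton] at hp
    rcases hp with rfl | rfl <;> simp [parityItp]

theorem last_mem_certAns_endpointInstance {n : ℤ} (hn : 1 ≤ n) :
    n ∈ certAns evenOddOntology (.atom 0) (endpointInstance n hn) ↔ Even n := by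
  constructor
  · intro h
    exact (h.2 _ (parityItp_isModel hn)).1 rfl
  · rintro ⟨k, hk⟩
    refine ⟨by rw [endpointInstance_tem]; exact ⟨by omega, le_rfl⟩, fun M hM => ?_⟩
    have h := even_mem_of_models_evenOdd hM.1 (hM.2 (0, 0) (by simp [endpointInstance])) k.toNat
    have hn' : (2 * k.toNat : ℤ) = n := by omega
    rwa [hn'] at h

/-! ## An Ehrenfeucht–Fraïssé argument for finite linear orders -/

/-- Two integers agree up to the threshold `t`. -/
def AgreeUpTo (t u v : ℤ) : Prop := u = v ∨ (t ≤ u ∧ t ≤ v) ∨ (u ≤ -t ∧ v ≤ -t)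

/-- `R` is a partial correspondence between `[0, n]` and `[0, m]` matching the endpoints and
preserving distances up to the threshold `t`. -/
structure DistSim (t n m : ℤ) (R : ℤ → ℤ → Prop) : Prop where
  zero : R 0 0
  last : R n m
  dist : ∀ {a a' b b'}, R a a' → R b b' → AgreeUpTo t (a - b) (a' - b')

theorem DistSim.swap {t n m : ℤ} {R : ℤ → ℤ → Prop} (h : DistSim t n m R) :
    DistSim t m n (flip R) where
  zero := h.zero
  last := h.last
  dist ha hb := by
    have := h.dist ha hb
    unfold AgreeUpTo at *
    omega

theorem DistSim.anti {s t n m : ℤ} {R : ℤ → ℤ → Prop} (h : DistSim t n m R) (hst : s ≤ t) :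
    DistSim s n m R where
  zero := h.zero
  last := h.last
  dist ha hb := by
    have := h.dist ha hb
    unfold AgreeUpTo at *
    omega

theorem DistSim.exists_extend {t n m d : ℤ} {R : ℤ → ℤ → Prop} (h : DistSim (2 * t) n m R)
    (ht : 0 < t) (hd : d ∈ Set.Icc 0 n) :
    ∃ d' ∈ Set.Icc 0 m, ∃ R' : ℤ → ℤ → Prop,
      DistSim t n m R' ∧ (∀ a b, R a b → R' a b) ∧ R' d d' := by
  obtain ⟨hd0, hdn⟩ := hd
  obtain ⟨a, ⟨had, a', haa'⟩, ha⟩ := Int.exists_greatest_of_bdd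
    (P := fun a => a ≤ d ∧ ∃ a', R a a') ⟨d, fun z hz => hz.1⟩ ⟨0, hd0, 0, h.zero⟩
  obtain ⟨b, ⟨hdb, b', hbb'⟩, hb⟩ := Int.exists_least_of_bdd
    (P := fun b => d ≤ b ∧ ∃ b', R b b') ⟨d, fun z hz => hz.1⟩ ⟨n, hdn, m, h.last⟩
  have hab := h.dist haa' hbb'
  have key : ∃ d', ∀ c c', R c c' → AgreeUpTo t (c - d) (c' - d') := by
    refine ⟨if d - a < t then a' + (d - a) else if b - d < t then b' - (b - d) else a' + t, ?_⟩
    intro c c' hc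
    have hca := h.dist hc haa'
    have hcb := h.dist hc hbb'
    have hle : c ≤ a ∨ b ≤ c :=
      (le_total c d).imp (fun hcd => ha c ⟨hcd, c', hc⟩) (fun hdc => hb c ⟨hdc, c', hc⟩)
    unfold AgreeUpTo at *
    split_ifs <;> omega
  obtain ⟨d', hd'⟩ := key
  have h0 := hd' _ _ h.zero
  have hm := hd' _ _ h.last
  refine ⟨d', ?_, fun x y => R x y ∨ (x = d ∧ y = d'), ⟨.inl h.zero, .inl h.last, ?_⟩,
    fun _ _ => .inl, .inr ⟨rfl, rfl⟩⟩
  · unfold AgreeUpTo at *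
    constructor <;> omega
  · rintro x x' y y' (hx | ⟨rfl, rfl⟩) (hy | ⟨rfl, rfl⟩)
    · have := h.dist hx hy
      unfold AgreeUpTo at *
      omega
    · exact hd' _ _ hx
    · have := hd' _ _ hy
      unfold AgreeUpTo at *
      omega
    · exact .inl (by omega)

/-- Every FO(<)-formula is preserved, on the structures of the instances `{A(0), C(n)}`, by the
correspondences that preserve distances up to a large enough threshold. -/
theorem Fml.IsFOlt.exists_threshold {φ : Fml} (hφ : φ.IsFOlt) :
    ∃ t : ℤ, 0 < t ∧ ∀ (n m : ℤ) (hn : 1 ≤ n) (hm : 1 ≤ m) (R : ℤ → ℤ → Prop),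
      DistSim t n m R → ∀ (e e' : ℕ → ℤ) (senv : ℕ → Set ℤ) (prev : ℕ → Prop)
        (Q : ℕ → ℤ → Prop), (∀ x, R (e x) (e' x)) →
      φ.eval (Set.Icc 0 n) (endpointInstance n hn).itp e senv prev Q →
      φ.eval (Set.Icc 0 m) (endpointInstance m hm).itp e' senv prev Q := by
  induction φ with
  | falsum => exact ⟨1, one_pos, fun _ _ _ _ _ _ _ _ _ _ _ _ h => h⟩
  | atom a x =>
    refine ⟨1, one_pos, fun n m hn hm R hR e e' senv prev Q he h => ?_⟩
    have h0 := hR.dist (he x) hR.zero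
    have hl := hR.dist (he x) hR.last
    simp only [Fml.eval, mem_endpointInstance_itp, AgreeUpTo] at *
    omega
  | lt x y =>
    refine ⟨1, one_pos, fun n m hn hm R hR e e' senv prev Q he h => ?_⟩
    have hxy := hR.dist (he x) (he y)
    simp only [Fml.eval, AgreeUpTo] at *
    omega
  | eq x y =>
    refine ⟨1, one_pos, fun n m hn hm R hR e e' senv prev Q he h => ?_⟩
    have hxy := hR.dist (he x) (he y)
    simp only [Fml.eval, AgreeUpTo] at *
    omega
  | neg φ ih =>
    obtain ⟨t, ht, H⟩ := ih hφ
    exact ⟨t, ht, fun n m hn hm R hR e e' senv prev Q he h h' =>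
      h (H m n hm hn _ hR.swap e' e senv prev Q he h')⟩
  | and φ ψ ihφ ihψ =>
    obtain ⟨s, hs, H⟩ := ihφ hφ.1
    obtain ⟨t, ht, K⟩ := ihψ hφ.2
    exact ⟨max s t, lt_max_of_lt_left hs, fun n m hn hm R hR e e' senv prev Q he h =>
      ⟨H n m hn hm R (hR.anti (le_max_left s t)) e e' senv prev Q he h.1,
        K n m hn hm R (hR.anti (le_max_right s t)) e e' senv prev Q he h.2⟩⟩
  | or φ ψ ihφ ihψ =>
    obtain ⟨s, hs, H⟩ := ihφ hφ.1
    obtain ⟨t, ht, K⟩ := ihψ hφ.2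
    exact ⟨max s t, lt_max_of_lt_left hs, fun n m hn hm R hR e e' senv prev Q he h =>
      h.imp (H n m hn hm R (hR.anti (le_max_left s t)) e e' senv prev Q he)
        (K n m hn hm R (hR.anti (le_max_right s t)) e e' senv prev Q he)⟩
  | ex x φ ih =>
    obtain ⟨t, ht, H⟩ := ih hφ
    refine ⟨2 * t, by omega, fun n m hn hm R hR e e' senv prev Q he h => ?_⟩
    obtain ⟨d, hd, hφd⟩ := h
    obtain ⟨d', hd', R', hR', hsub, hdd'⟩ := hR.exists_extend ht hd
    refine ⟨d', hd', H n m hn hm R' hR' _ _ senv prev Q (fun y => ?_) hφd⟩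
    rcases eq_or_ne y x with rfl | hy
    · simpa using hdd'
    · simpa [hy] using hsub _ _ (he y)
  | all x φ ih =>
    obtain ⟨t, ht, H⟩ := ih hφ
    refine ⟨2 * t, by omega, fun n m hn hm R hR e e' senv prev Q he h d' hd' => ?_⟩
    obtain ⟨d, hd, R', hR', hsub, hdd'⟩ := hR.swap.exists_extend ht hd'
    refine H n m hn hm (flip R') hR'.swap _ _ senv prev Q (fun y => ?_) (h d hd)
    rcases eq_or_ne y x with rfl | hy
    · simpa [flip] using hdd'
    · simpa [flip, hy] using hsub _ _ (he y)
  | _ => exact hφ.elim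

theorem distSim_endpoints {t n m : ℤ} (hn : t ≤ n) (hm : t ≤ m) :
    DistSim t n m (fun x y => (x = 0 ∧ y = 0) ∨ (x = n ∧ y = m)) where
  zero := .inl ⟨rfl, rfl⟩
  last := .inr ⟨rfl, rfl⟩
  dist := by
    unfold AgreeUpTo
    omega

/-- the OMAQ `({○P A → B, ○P B → A}, A)` is not
FO(<)-rewritable. -/
theorem evenOdd_OMAQ_not_FOlt_rewritable :
    ¬ ∃ φ : Fml, φ.IsFOlt ∧ φ.fvars ⊆ {0} ∧
      ∀ A : DataInstance,
        certAns evenOddOntology (.atom 0) A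
          = {ℓ ∈ A.tem | Fml.evalIn A.tem A.itp φ (fun _ => ℓ)} := by
  rintro ⟨φ, hφ, -, hans⟩
  obtain ⟨t, ht, H⟩ := hφ.exists_threshold
  have hn : 1 ≤ 2 * t := by omega
  have hm : 1 ≤ 2 * t + 1 := by omega
  have hsim : DistSim t (2 * t) (2 * t + 1) _ := distSim_endpoints (by omega) (by omega)
  have heven := (last_mem_certAns_endpointInstance hn).2 (even_two_mul t)
  rw [hans, endpointInstance_tem] at heven
  have hodd : 2 * t + 1 ∈ certAns evenOddOntology (.atom 0) (endpointInstance _ hm) := by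
    rw [hans, endpointInstance_tem]
    exact ⟨⟨by omega, le_rfl⟩,
      H _ _ hn hm _ hsim _ _ _ _ _ (fun _ => .inr ⟨rfl, rfl⟩) heven.2⟩
  exact Int.not_even_two_mul_add_one t ((last_mem_certAns_endpointInstance hm).1 hodd)

end LTLOMQ
end
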